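/- arXiv:2012.07375 — 3 statements merged into one kernel-verified Lean document; each statement's English description precedes it below -/
import Mathlib

section
/- Let T be a tree of order n ≥ 4 with maximum degree at least 3. Then hc(T) ≥ (n−1)(n−1−ζ(T)) + ζ'(T) − 2L_W(T). -/
open SimpleGraph Finset

namespace HCPaper

variable {V : Type*}

/-- The detour distance `D(u,v)`: the length of a longest `u`–`v` path. -/
noncomputable def detourDist (G : SimpleGraph V) (u v : V) : ℕ :=
  sSup {n | ∃ p : G.Walk u v, p.IsPath ∧ p.length = n}

/-- A hamiltonian coloring: `D(u,v) + |h u - h v| ≥ n - 1` for all distinct `u, v`. -/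
def IsHamiltonianColoring [Fintype V] (G : SimpleGraph V) (h : V → ℕ) : Prop :=
  ∀ u v : V, u ≠ v →
    Fintype.card V - 1 ≤ detourDist G u v + Nat.dist (h u) (h v)

/-- The span of a coloring: the maximum of `|h u - h v|`. -/
noncomputable def spanOf (h : V → ℕ) : ℕ :=
  sSup (Set.range fun p : V × V => Nat.dist (h p.1) (h p.2))

/-- The hamiltonian chromatic number: minimum span over hamiltonian colorings. -/
noncomputable def hc [Fintype V] (G : SimpleGraph V) : ℕ :=
  sInf {s | ∃ h : V → ℕ, IsHamiltonianColoring G h ∧ spanOf h = s}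

/-- The weight of the graph from a vertex `v`. -/
noncomputable def treeWeight [Fintype V] (G : SimpleGraph V) (v : V) : ℕ :=
  ∑ u, G.dist u v

/-- The set of weight centers. -/
def WeightCenters [Fintype V] (G : SimpleGraph V) : Set V :=
  {v | ∀ u, treeWeight G v ≤ treeWeight G u}

/-- The detour level `L(u) = min {d(u,w) : w ∈ W(T)}`. -/
noncomputable def detourLevel [Fintype V] (G : SimpleGraph V) (u : V) : ℕ :=
  sInf {k | ∃ w ∈ WeightCenters G, G.dist u w = k}

/-- The total detour level `L_W(T) = ∑ L(u)`. -/
noncomputable def totalDetourLevel [Fintype V] (G : SimpleGraph V) : ℕ :=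
  ∑ u, detourLevel G u

/-- `ζ(T)` : 0 if one weight center, 1 if two. -/
noncomputable def zeta [Fintype V] (G : SimpleGraph V) : ℕ :=
  if (WeightCenters G).ncard = 2 then 1 else 0

/-- `ζ'(T) = 1 - ζ(T)`. -/
noncomputable def zeta' [Fintype V] (G : SimpleGraph V) : ℕ := 1 - zeta G

/-- `t` is an ancestor of `v` : `t` lies on the path joining the nearest weight center and `v`. -/
def IsAncestor [Fintype V] (G : SimpleGraph V) (t v : V) : Prop :=
  ∃ w ∈ WeightCenters G, G.dist v w = detourLevel G v ∧
    ∃ p : G.Walk w v, p.IsPath ∧ t ∈ p.support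

/-- `φ(u,v)`: maximum detour level of a common ancestor of `u` and `v`. -/
noncomputable def phi [Fintype V] (G : SimpleGraph V) (u v : V) : ℕ :=
  sSup {k | ∃ t, IsAncestor G t u ∧ IsAncestor G t v ∧ detourLevel G t = k}

open Classical in
/-- `δ(u,v)`: 1 if there are two weight centers `w, w'` and the `u`–`v` path contains
the edge `ww'`, 0 otherwise. -/
noncomputable def delta [Fintype V] (G : SimpleGraph V) (u v : V) : ℕ :=
  if ∃ w w', w ≠ w' ∧ WeightCenters G = {w, w'} ∧
      ∃ p : G.Walk u v, p.IsPath ∧ s(w, w') ∈ p.edges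
  then 1 else 0

/-- `u` and `v` lie in different branches: branches at two distinct vertices adjacent to
the same weight center. -/
def InDifferentBranches [Fintype V] (G : SimpleGraph V) (u v : V) : Prop :=
  ∃ w b₁ b₂, w ∈ WeightCenters G ∧ b₁ ≠ b₂ ∧
    b₁ ∉ WeightCenters G ∧ b₂ ∉ WeightCenters G ∧
    G.Adj w b₁ ∧ G.Adj w b₂ ∧ IsAncestor G b₁ u ∧ IsAncestor G b₂ v

/-- `u` and `v` lie in opposite branches: branches at vertices adjacent to different
weight centers. -/
def InOppositeBranches [Fintype V] (G : SimpleGraph V) (u v : V) : Prop :=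
  ∃ w₁ w₂ b₁ b₂, w₁ ∈ WeightCenters G ∧ w₂ ∈ WeightCenters G ∧ w₁ ≠ w₂ ∧
    b₁ ∉ WeightCenters G ∧ b₂ ∉ WeightCenters G ∧
    G.Adj w₁ b₁ ∧ G.Adj w₂ b₂ ∧ IsAncestor G b₁ u ∧ IsAncestor G b₂ v

/-- The eccentricity of a vertex. -/
noncomputable def ecc (G : SimpleGraph V) (v : V) : ℕ :=
  sSup (Set.range fun u => G.dist v u)

/-- The center of a graph: vertices of minimum eccentricity. -/
def graphCenter (G : SimpleGraph V) : Set V :=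
  {v | ∀ u, ecc G v ≤ ecc G u}

/-- The total level with respect to the center `C(T)`. -/
noncomputable def totalLevel [Fintype V] (G : SimpleGraph V) : ℕ :=
  ∑ u, sInf {k | ∃ x ∈ graphCenter G, G.dist u x = k}

/-- `ε(T)` : 0 if the center has one vertex, 1 if two. -/
noncomputable def eps [Fintype V] (G : SimpleGraph V) : ℕ :=
  if (graphCenter G).ncard = 2 then 1 else 0

/-- `ε'(T) = 1 - ε(T)`. -/
noncomputable def eps' [Fintype V] (G : SimpleGraph V) : ℕ := 1 - eps G

/-- The weight-center based lower bound `lb_W(T)`. -/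
noncomputable def lbW [Fintype V] (G : SimpleGraph V) : ℤ :=
  ((Fintype.card V : ℤ) - 1) * ((Fintype.card V : ℤ) - 1 - zeta G) +
    zeta' G - 2 * totalDetourLevel G

/-- The center based lower bound `lb(T)`. -/
noncomputable def lbC [Fintype V] (G : SimpleGraph V) : ℤ :=
  ((Fintype.card V : ℤ) - 1) * ((Fintype.card V : ℤ) - 1 - eps G) +
    eps' G - 2 * totalLevel G

/-- The broom `B_{n,d}`: a path on vertices `0, …, d-1` together with `n - d` pendant
vertices all adjacent to the end vertex `d-1` of the path. -/
def broom (n d : ℕ) : SimpleGraph (Fin n) :=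
  SimpleGraph.fromRel (fun i j =>
    (i.val + 1 = j.val ∧ j.val < d) ∨ (i.val + 1 = d ∧ d ≤ j.val))

/-- The star `K_{1,n-1}`: vertex `0` adjacent to the `n - 1` other vertices. -/
def starGraph (n : ℕ) : SimpleGraph (Fin n) :=
  SimpleGraph.fromRel (fun i _ => i.val = 0)

/-- The caterpillar `C(m,d)`: a spine `v_1, …, v_m` with `d - 2` legs attached to each
inner spine vertex `v_2, …, v_{m-1}` (so each inner spine vertex has degree `d`). -/
def caterpillar (m d : ℕ) : SimpleGraph (Fin m ⊕ Fin (m - 2) × Fin (d - 2)) :=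
  SimpleGraph.fromRel (fun x y =>
    (∃ i j : Fin m, x = Sum.inl i ∧ y = Sum.inl j ∧ i.val + 1 = j.val) ∨
    (∃ i : Fin m, ∃ a : Fin (m - 2), ∃ b : Fin (d - 2),
      x = Sum.inl i ∧ y = Sum.inr (a, b) ∧ i.val = a.val + 1))

lemma dist_eq_length_of_isPath {G : SimpleGraph V} (hT : G.IsTree) {u v : V}
    {p : G.Walk u v} (hp : p.IsPath) : G.dist u v = p.length := by
  obtain ⟨q, hq, hl⟩ := hT.connected.exists_path_of_dist u v
  rw [← hl, (hT.existsUnique_path u v).unique hq hp]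

lemma detourDist_le_dist {G : SimpleGraph V} (hT : G.IsTree) (u v : V) :
    detourDist G u v ≤ G.dist u v := by
  refine csSup_le' ?_
  rintro _ ⟨p, hp, rfl⟩
  exact (dist_eq_length_of_isPath hT hp).ge

lemma dist_add_dist_of_mem_support {G : SimpleGraph V} (hT : G.IsTree) {u v x : V}
    {p : G.Walk u v} (hp : p.IsPath) (hx : x ∈ p.support) :
    G.dist u v = G.dist u x + G.dist x v := by
  classical
  rw [dist_eq_length_of_isPath hT hp, dist_eq_length_of_isPath hT (hp.takeUntil hx),
    dist_eq_length_of_isPath hT (hp.dropUntil hx), ← SimpleGraph.Walk.length_append,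
    SimpleGraph.Walk.take_spec]

/-- A vertex on the path from `w` to `w'` separates every vertex from `w` or from `w'`. -/
lemma dist_split_of_mem_support {G : SimpleGraph V} (hT : G.IsTree) {w w' x : V}
    {p : G.Walk w w'} (hp : p.IsPath) (hx : x ∈ p.support) (u : V) :
    G.dist u w = G.dist u x + G.dist x w ∨ G.dist u w' = G.dist u x + G.dist x w' := by
  classical
  obtain ⟨P, hP, -⟩ := hT.connected.exists_path_of_dist u w
  obtain ⟨Q, hQ, -⟩ := hT.connected.exists_path_of_dist u w'
  have he : (P.reverse.append Q).bypass = p :=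
    (hT.existsUnique_path w w').unique (SimpleGraph.Walk.bypass_isPath _) hp
  have hmem := SimpleGraph.Walk.support_bypass_subset_support (P.reverse.append Q) (he ▸ hx)
  rw [SimpleGraph.Walk.mem_support_append_iff, SimpleGraph.Walk.support_reverse,
    List.mem_reverse] at hmem
  exact hmem.imp (dist_add_dist_of_mem_support hT hP) (dist_add_dist_of_mem_support hT hQ)

lemma adj_of_mem_weightCenters [Fintype V] {G : SimpleGraph V} (hT : G.IsTree) {w w' : V}
    (hw : w ∈ WeightCenters G) (hw' : w' ∈ WeightCenters G) (hne : w ≠ w') : G.Adj w w' := by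
  obtain ⟨p, hp, hl⟩ := hT.connected.exists_path_of_dist w w'
  cases p with
  | nil => exact absurd rfl hne
  | @cons _ x _ hadj q =>
    by_contra hnadj
    have hq : q.IsPath := hp.of_cons
    have hxw' := dist_eq_length_of_isPath hT hq
    have hxw : G.dist x w = 1 := SimpleGraph.dist_eq_one_iff_adj.2 hadj.symm
    have hpos : 0 < q.length := by
      rcases Nat.eq_zero_or_pos q.length with h0 | h0
      · exact absurd (SimpleGraph.Walk.eq_of_length_eq_zero h0 ▸ hadj) hnadj
      · exact h0
    have hle : ∀ u, (q.length + 1) * G.dist u x ≤ q.length * G.dist u w + G.dist u w' := by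
      intro u
      have hx : x ∈ (SimpleGraph.Walk.cons hadj q).support := by simp
      have t1 := hT.connected.dist_triangle (u := u) (v := w) (w := x)
      have t2 := hT.connected.dist_triangle (u := u) (v := w') (w := x)
      rw [SimpleGraph.dist_comm (u := w)] at t1
      rw [SimpleGraph.dist_comm (u := w')] at t2
      rcases dist_split_of_mem_support hT hp hx u with h | h <;> nlinarith
    have hlt : ∑ u, (q.length + 1) * G.dist u x
        < ∑ u, (q.length * G.dist u w + G.dist u w') := by
      refine Finset.sum_lt_sum (fun u _ => hle u) ⟨x, Finset.mem_univ _, ?_⟩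
      rw [SimpleGraph.dist_self, hxw]
      omega
    rw [Finset.sum_add_distrib, ← Finset.mul_sum, ← Finset.mul_sum] at hlt
    have h1 := hw x
    have h2 := hw' x
    unfold treeWeight at h1 h2
    nlinarith

lemma weightCenters_nonempty [Fintype V] [Nonempty V] (G : SimpleGraph V) :
    (WeightCenters G).Nonempty :=
  Finite.exists_min (treeWeight G)

lemma exists_dist_eq_detourLevel [Fintype V] [Nonempty V] (G : SimpleGraph V) (u : V) :
    ∃ w ∈ WeightCenters G, G.dist u w = detourLevel G u := by
  obtain ⟨w, hw⟩ := weightCenters_nonempty G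
  exact Nat.sInf_mem (s := {k | ∃ w ∈ WeightCenters G, G.dist u w = k}) ⟨_, w, hw, rfl⟩

/-- Distinct weight centers of a tree exhaust its set of weight centers. -/
lemma zeta_eq_one [Fintype V] {G : SimpleGraph V} (hT : G.IsTree) {w w' : V}
    (hw : w ∈ WeightCenters G) (hw' : w' ∈ WeightCenters G) (hne : w ≠ w') : zeta G = 1 := by
  have hset : WeightCenters G = {w, w'} := by
    refine Set.Subset.antisymm (fun x hx => ?_) (by rintro x (rfl | rfl) <;> assumption)
    by_contra hxn
    simp only [Set.mem_insert_iff, Set.mem_singleton_iff, not_or] at hxn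
    have h1 := adj_of_mem_weightCenters hT hw hw' hne
    have h2 := adj_of_mem_weightCenters hT hw hx (Ne.symm hxn.1)
    have h3 := adj_of_mem_weightCenters hT hx hw' hxn.2
    have hp : (SimpleGraph.Walk.cons h2 (SimpleGraph.Walk.cons h3 .nil)).IsPath := by
      simp [SimpleGraph.Walk.cons_isPath_iff, hne, hxn.2, Ne.symm hxn.1]
    have h4 := dist_eq_length_of_isPath hT hp
    rw [SimpleGraph.dist_eq_one_iff_adj.2 h1] at h4
    simp at h4
  rw [zeta, if_pos (hset ▸ Set.ncard_pair hne)]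

lemma dist_le_detourLevel_add [Fintype V] {G : SimpleGraph V} (hT : G.IsTree) (u v : V) :
    G.dist u v ≤ detourLevel G u + detourLevel G v + zeta G := by
  have : Nonempty V := ⟨u⟩
  obtain ⟨w, hw, hu⟩ := exists_dist_eq_detourLevel G u
  obtain ⟨w', hw', hv⟩ := exists_dist_eq_detourLevel G v
  have t1 := hT.connected.dist_triangle (u := u) (v := w) (w := v)
  have t2 := hT.connected.dist_triangle (u := w) (v := w') (w := v)
  rw [SimpleGraph.dist_comm (u := w') (v := v)] at t2
  have h : G.dist w w' ≤ zeta G := by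
    by_cases hne : w = w'
    · simp [hne]
    · rw [zeta_eq_one hT hw hw' hne,
        SimpleGraph.dist_eq_one_iff_adj.2 (adj_of_mem_weightCenters hT hw hw' hne)]
  omega

lemma zeta'_le_detourLevel_add [Fintype V] {G : SimpleGraph V} (hT : G.IsTree) {u v : V}
    (huv : u ≠ v) : zeta' G ≤ detourLevel G u + detourLevel G v := by
  have h := dist_le_detourLevel_add hT u v
  have hpos := hT.connected.pos_dist_of_ne huv
  unfold zeta'
  omega

lemma exists_isHamiltonianColoring [Fintype V] (G : SimpleGraph V) :
    ∃ h : V → ℕ, IsHamiltonianColoring G h := by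
  refine ⟨fun v => Fintype.card V * Fintype.equivFin V v, fun u v huv => ?_⟩
  have hne : (Fintype.equivFin V u : ℕ) ≠ Fintype.equivFin V v := fun h =>
    huv ((Fintype.equivFin V).injective (Fin.ext h))
  rw [Nat.dist_mul_left]
  have hpos := Nat.dist_pos_of_ne hne
  have := Nat.le_mul_of_pos_right (Fintype.card V) hpos
  omega

lemma dist_le_spanOf [Finite V] (h : V → ℕ) (u v : V) : Nat.dist (h u) (h v) ≤ spanOf h :=
  le_csSup (Set.finite_range _).bddAbove ⟨(u, v), rfl⟩

/-- Summing the coloring condition along an ordering of the vertices by color. -/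
lemma sum_detourLevel_le_of_monotone [Fintype V] {G : SimpleGraph V} (hT : G.IsTree)
    {h : V → ℕ} (hh : IsHamiltonianColoring G h) {N : ℕ} {e : Fin N → V}
    (he : Function.Injective e) (hmono : Monotone (h ∘ e)) (k : ℕ) (hk : k < N) :
    (k : ℤ) * ((Fintype.card V : ℤ) - 1 - zeta G) + detourLevel G (e ⟨0, by omega⟩)
        + detourLevel G (e ⟨k, hk⟩)
        - 2 * ∑ j : Fin (k + 1), (detourLevel G (e (j.castLE hk)) : ℤ)
      ≤ (h (e ⟨k, hk⟩) : ℤ) - h (e ⟨0, by omega⟩) := by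
  induction k with
  | zero => simp [Fin.castLE]; omega
  | succ k ih =>
    have ih := ih (by omega)
    rw [Fin.sum_univ_castSucc]
    have hne : e ⟨k, by omega⟩ ≠ e ⟨k + 1, hk⟩ := fun hc => by simpa using he hc
    have hc := hh _ _ hne
    have hm : h (e ⟨k, by omega⟩) ≤ h (e ⟨k + 1, hk⟩) := hmono (Fin.mk_le_mk.2 (by omega))
    have hd := (detourDist_le_dist hT _ _).trans
      (dist_le_detourLevel_add hT (e ⟨k, by omega⟩) (e ⟨k + 1, hk⟩))
    rw [Nat.dist_eq_sub_of_le hm] at hc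
    have hlast : (Fin.last (k + 1)).castLE hk = ⟨k + 1, hk⟩ := rfl
    have hcast : ∀ j : Fin (k + 1), j.castSucc.castLE hk = j.castLE (by omega) := fun _ => rfl
    simp only [hlast, hcast]
    push_cast
    rw [add_mul, one_mul]
    omega

/-- Lower bound: `hc(T) ≥ (n-1)(n-1-ζ(T)) + ζ'(T) - 2 L_W(T)`. -/
theorem stmt5 [Fintype V] {G : SimpleGraph V} (hT : G.IsTree)
    (hn : 4 ≤ Fintype.card V) (hdeg : ∃ v, 3 ≤ (G.neighborSet v).ncard) :
    ((Fintype.card V : ℤ) - 1) * ((Fintype.card V : ℤ) - 1 - zeta G) +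
        zeta' G - 2 * totalDetourLevel G ≤ (hc G : ℤ) := by
  obtain ⟨h, hh, hs⟩ : ∃ h : V → ℕ, IsHamiltonianColoring G h ∧ spanOf h = hc G := by
    obtain ⟨h, hh⟩ := exists_isHamiltonianColoring G
    exact Nat.sInf_mem (s := {s | ∃ h : V → ℕ, IsHamiltonianColoring G h ∧ spanOf h = s})
      ⟨_, h, hh, rfl⟩
  obtain ⟨N, hN⟩ : ∃ N, Fintype.card V = N + 1 := ⟨Fintype.card V - 1, by omega⟩
  let e₀ : Fin (N + 1) ≃ V := (Fintype.equivFinOfCardEq hN).symm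
  let e : Fin (N + 1) ≃ V := (Tuple.sort (h ∘ e₀)).trans e₀
  have hmono : Monotone (h ∘ e) := Tuple.monotone_sort (h ∘ e₀)
  have key := sum_detourLevel_le_of_monotone hT hh e.injective hmono N (by omega)
  have hsum : ∑ j : Fin (N + 1), (detourLevel G (e (j.castLE le_rfl)) : ℤ)
      = totalDetourLevel G := by
    rw [totalDetourLevel, Nat.cast_sum]
    exact e.sum_comp fun v => (detourLevel G v : ℤ)
  rw [hsum] at key
  have hne : e ⟨0, by omega⟩ ≠ e ⟨N, by omega⟩ := fun hc => by
    have := Fin.mk.inj_iff.1 (e.injective hc)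
    omega
  have hz := zeta'_le_detourLevel_add hT hne
  have hspan := dist_le_spanOf h (e ⟨0, by omega⟩) (e ⟨N, by omega⟩)
  have hm : h (e ⟨0, by omega⟩) ≤ h (e ⟨N, by omega⟩) := hmono (Fin.mk_le_mk.2 (by omega))
  rw [Nat.dist_eq_sub_of_le hm, hs] at hspan
  have hcard : (Fintype.card V : ℤ) - 1 = N := by omega
  rw [hcard] at key ⊢
  omega

end HCPaper
end

section
/- Let k ≥ 1 be an integer. The broom tree B_{2k+1} = B_{(k+1)(2k+1),2k+1} has a unique weight center, namely the end vertex of the path to which the k(2k+1) pendant vertices are attached, and its total detour level is L_W(B_{2k+1}) = 2k(2k+1). -/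
open SimpleGraph Finset

namespace HCPaper

variable {V : Type*}

lemma broom_adj {n m : ℕ} {u v : Fin n} :
    (broom n (m + 1)).Adj u v ↔
      (u.val + 1 = v.val ∧ v.val ≤ m ∨ u.val = m ∧ m < v.val) ∨
      (v.val + 1 = u.val ∧ u.val ≤ m ∨ v.val = m ∧ m < u.val) := by
  simp only [broom, SimpleGraph.fromRel_adj, ne_eq, Fin.ext_iff]
  omega

/-- The distance of the `i`-th vertex of the broom to the attachment vertex `m`. -/
def distToAttachment (m i : ℕ) : ℕ := if i ≤ m then m - i else 1

lemma exists_walk_to_attachment {n m : ℕ} (c : Fin n) (hc : c.val = m) (u : Fin n) :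
    ∃ p : (broom n (m + 1)).Walk u c, p.length = distToAttachment m u.val := by
  unfold distToAttachment
  by_cases hu : u.val ≤ m
  · rw [if_pos hu]
    obtain ⟨t, ht⟩ : ∃ t, m - u.val = t := ⟨_, rfl⟩
    induction t generalizing u with
    | zero =>
      obtain rfl : u = c := Fin.ext (by omega)
      exact ⟨.nil, by simp; omega⟩
    | succ t ih =>
      have hn := c.isLt
      obtain ⟨p, hp⟩ := ih ⟨u.val + 1, by omega⟩ (by simp; omega) (by simp; omega)
      refine ⟨.cons (broom_adj.mpr ?_) p, ?_⟩
      · simp; omega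
      · simp only [SimpleGraph.Walk.length_cons, hp]; omega
  · rw [if_neg hu]
    exact ⟨.cons (broom_adj.mpr (by omega)) .nil, rfl⟩

lemma broom_connected {n m : ℕ} (hm : m < n) : (broom n (m + 1)).Connected := by
  have key (u : Fin n) : (broom n (m + 1)).Reachable u ⟨m, hm⟩ :=
    (exists_walk_to_attachment ⟨m, hm⟩ rfl u).elim fun p _ => p.reachable
  exact { preconnected := fun u v => (key u).trans (key v).symm, nonempty := ⟨⟨m, hm⟩⟩ }

/-- The position along the path (all pendant vertices being in position `m + 1`) is
Lipschitz with constant one for the distance of the broom. -/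
lemma min_val_le_add_dist {n m : ℕ} (hm : m < n) (u v : Fin n) :
    min u.val (m + 1) ≤ min v.val (m + 1) + (broom n (m + 1)).dist u v := by
  obtain ⟨p, hp⟩ := (broom_connected hm).exists_walk_length_eq_dist u v
  rw [← hp]
  clear hp
  induction p with
  | nil => simp
  | cons h p ih =>
    rw [broom_adj] at h
    simp only [SimpleGraph.Walk.length_cons]
    omega

lemma dist_attachment {n m : ℕ} (c : Fin n) (hc : c.val = m) (u : Fin n) :
    (broom n (m + 1)).dist u c = distToAttachment m u.val := by
  have hm : m < n := hc ▸ c.isLt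
  apply le_antisymm
  · obtain ⟨p, hp⟩ := exists_walk_to_attachment c hc u
    exact hp ▸ SimpleGraph.dist_le p
  · have h₁ := min_val_le_add_dist hm u c
    have h₂ := min_val_le_add_dist hm c u
    rw [SimpleGraph.dist_comm] at h₂
    unfold distToAttachment
    split_ifs <;> omega

lemma two_le_dist_of_pendant {n m : ℕ} (hm : m < n) {u v : Fin n} (hne : u ≠ v)
    (hu : m < u.val) (hv : m < v.val) : 2 ≤ (broom n (m + 1)).dist u v := by
  have h₀ := (broom_connected hm).pos_dist_of_ne hne
  have h₁ : (broom n (m + 1)).dist u v ≠ 1 := fun h => by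
    rw [SimpleGraph.dist_eq_one_iff_adj, broom_adj] at h
    omega
  omega

lemma treeWeight_lt_of_pendant {n m : ℕ} (hn : 2 < n) (c w : Fin n) (hc : c.val = m)
    (hw : m < w.val) :
    treeWeight (broom n (m + 1)) c < treeWeight (broom n (m + 1)) w := by
  have hm : m < n := hc ▸ c.isLt
  have key : ∑ u : Fin n, (distToAttachment m u.val + 1) ≤
      ∑ u, ((broom n (m + 1)).dist u w + if u = w then 2 else 0) := by
    refine Finset.sum_le_sum fun u _ => ?_
    have h₁ := min_val_le_add_dist hm w u
    rw [SimpleGraph.dist_comm] at h₁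
    unfold distToAttachment
    by_cases huw : u = w
    · subst huw
      simp [hw.not_ge]
    · have h₂ : m < u.val → 2 ≤ (broom n (m + 1)).dist u w :=
        fun hu => two_le_dist_of_pendant hm huw hu hw
      rw [if_neg huw]
      split_ifs <;> omega
  simp only [Finset.sum_add_distrib, Finset.sum_ite_eq', Finset.mem_univ, if_true,
    Finset.sum_const, Finset.card_univ, Fintype.card_fin, smul_eq_mul, mul_one] at key
  simp only [treeWeight, dist_attachment c hc]
  omega

lemma treeWeight_lt_of_path {n m : ℕ} (hn : 2 * (m + 1) ≤ n) (c w : Fin n) (hc : c.val = m)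
    (hw : w.val < m) :
    treeWeight (broom n (m + 1)) c < treeWeight (broom n (m + 1)) w := by
  have hm : m < n := hc ▸ c.isLt
  obtain ⟨t, ht⟩ : ∃ t, t + w.val = m := ⟨m - w.val, by omega⟩
  have key : ∑ u : Fin n, (distToAttachment m u.val + (t + if u = c then 2 * t else 0)) ≤
      ∑ u : Fin n, ((broom n (m + 1)).dist u w + if u.val < m + 1 then 2 * t else 0) := by
    refine Finset.sum_le_sum fun u _ => ?_
    have h₁ := min_val_le_add_dist hm w u
    have h₂ := min_val_le_add_dist hm u w
    rw [SimpleGraph.dist_comm] at h₁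
    unfold distToAttachment
    simp only [Fin.ext_iff]
    split_ifs <;> omega
  have hcard : (Finset.univ.filter fun u : Fin n => u.val < m + 1).card = m + 1 := by
    rw [Fin.card_filter_val_lt]; omega
  have hpath : ∑ u : Fin n, (if u.val < m + 1 then 2 * t else 0) = (m + 1) * (2 * t) := by
    rw [← Finset.sum_filter, Finset.sum_const, hcard, smul_eq_mul]
  rw [Finset.sum_add_distrib, Finset.sum_add_distrib, Finset.sum_add_distrib, hpath] at key
  simp only [Finset.sum_ite_eq', Finset.mem_univ, if_true,
    Finset.sum_const, Finset.card_univ, Fintype.card_fin, smul_eq_mul] at key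
  simp only [treeWeight, dist_attachment c hc]
  have := Nat.mul_le_mul_right t hn
  have : 2 * (m + 1) * t = (m + 1) * (2 * t) := by ring
  omega

lemma mem_weightCenters_broom_iff {n m : ℕ} (hm : 1 ≤ m) (hn : 2 * (m + 1) ≤ n) (w : Fin n) :
    w ∈ WeightCenters (broom n (m + 1)) ↔ w.val = m := by
  have lt (c v : Fin n) (hc : c.val = m) (hv : v.val ≠ m) :
      treeWeight (broom n (m + 1)) c < treeWeight (broom n (m + 1)) v := by
    rcases lt_or_gt_of_ne hv with h | h
    · exact treeWeight_lt_of_path hn c v hc h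
    · exact treeWeight_lt_of_pendant (by omega) c v hc h
  constructor
  · intro h
    by_contra hne
    exact (h ⟨m, by omega⟩).not_gt (lt _ w rfl hne)
  · intro h v
    by_cases hv : v.val = m
    · rw [Fin.ext (h.trans hv.symm)]
    · exact (lt w v h hv).le

lemma sum_range_distToAttachment (m r : ℕ) :
    2 * ∑ i ∈ Finset.range (m + 1 + r), distToAttachment m i = m * (m + 1) + 2 * r := by
  rw [Finset.sum_range_add, mul_add]
  congr 1
  · have hid : m * (m + 1) = 2 * ∑ i ∈ Finset.range (m + 1), i := by
      rw [mul_comm 2, Finset.sum_range_id_mul_two, Nat.add_sub_cancel, mul_comm]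
    rw [hid, ← Finset.sum_range_reflect (fun i => i)]
    congr 1
    refine Finset.sum_congr rfl fun i hi => ?_
    have := Finset.mem_range.mp hi
    unfold distToAttachment
    split_ifs <;> omega
  · have h (i : ℕ) : distToAttachment m (m + 1 + i) = 1 := if_neg (by omega)
    simp [h]

lemma detourLevel_eq_dist {W : Type*} [Fintype W] {G : SimpleGraph W} {c : W}
    (hc : ∀ w, w ∈ WeightCenters G ↔ w = c) (u : W) : detourLevel G u = G.dist u c := by
  have : {k | ∃ w ∈ WeightCenters G, G.dist u w = k} = {G.dist u c} := by
    ext; simp [hc, eq_comm]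
  rw [detourLevel, this, csInf_singleton]

/-- `B_{2k+1}` has the unique weight center at the attachment end of the path (vertex
`d - 1 = 2k`), and `L_W(B_{2k+1}) = 2k(2k+1)`. -/
theorem stmt12 (k : ℕ) (hk : 1 ≤ k) :
    (∀ w : Fin ((k + 1) * (2 * k + 1)),
      w ∈ WeightCenters (broom ((k + 1) * (2 * k + 1)) (2 * k + 1)) ↔ w.val = 2 * k) ∧
    totalDetourLevel (broom ((k + 1) * (2 * k + 1)) (2 * k + 1)) = 2 * k * (2 * k + 1) := by
  have hn : 2 * (2 * k + 1) ≤ (k + 1) * (2 * k + 1) := Nat.mul_le_mul_right _ (by omega)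
  have hW := mem_weightCenters_broom_iff (by omega : 1 ≤ 2 * k) hn
  refine ⟨hW, ?_⟩
  let c : Fin ((k + 1) * (2 * k + 1)) := ⟨2 * k, by omega⟩
  have hc (w) : w ∈ WeightCenters (broom ((k + 1) * (2 * k + 1)) (2 * k + 1)) ↔ w = c :=
    (hW w).trans (Fin.ext_iff (b := c)).symm
  simp only [totalDetourLevel, detourLevel_eq_dist hc, dist_attachment (m := 2 * k) c rfl]
  rw [Fin.sum_univ_eq_sum_range (distToAttachment (2 * k))]
  have hsum := sum_range_distToAttachment (2 * k) (k * (2 * k + 1))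
  rw [show 2 * k + 1 + k * (2 * k + 1) = (k + 1) * (2 * k + 1) by ring] at hsum
  linarith

end HCPaper
end

section
/- For every integer d ≥ 3 (i.e., for the broom B_{2k} with k ≥ 2 and for the broom B_{2k+1} with k ≥ 1), the set of weight centers of B_d is different from the center of B_d: W(B_d) ≠ C(B_d). -/
open SimpleGraph Finset

namespace HCPaper

variable {V : Type*}

/-- The distance of a vertex of the broom from the free end `0` of its handle. -/
def broomLevel {n : ℕ} (d : ℕ) (i : Fin n) : ℕ := min i.val d

lemma broom_adj_level {n d : ℕ} {i j : Fin n} (h : (broom n d).Adj i j) :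
    Nat.dist (broomLevel d i) (broomLevel d j) ≤ 1 := by
  simp only [broom, SimpleGraph.fromRel_adj] at h
  simp only [broomLevel, Nat.dist]
  omega

lemma broom_walk_level {n d : ℕ} {i j : Fin n} (p : (broom n d).Walk i j) :
    Nat.dist (broomLevel d i) (broomLevel d j) ≤ p.length := by
  induction p with
  | nil => simp
  | @cons u v w h p ih =>
    have h1 := broom_adj_level h
    have h2 := Nat.dist.triangle_inequality (broomLevel d u) (broomLevel d v) (broomLevel d w)
    rw [SimpleGraph.Walk.length_cons]
    omega

lemma exists_broom_walk {n d : ℕ} (m : ℕ) (i j : Fin n) (hi : i.val < d)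
    (h : broomLevel d j = i.val + m) : ∃ p : (broom n d).Walk i j, p.length = m := by
  induction m generalizing i with
  | zero =>
    have hij : i = j := by
      ext
      simp only [broomLevel] at h
      omega
    subst hij
    exact ⟨.nil, rfl⟩
  | succ m ih =>
    have hj := j.isLt
    simp only [broomLevel] at h
    by_cases hd : i.val + 1 < d
    · have hadj : (broom n d).Adj i ⟨i.val + 1, by omega⟩ := by
        simp [broom, SimpleGraph.fromRel_adj, Fin.ext_iff, hd]
      obtain ⟨p, hp⟩ := ih ⟨i.val + 1, by omega⟩ hd (by simp only [broomLevel]; omega)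
      exact ⟨.cons hadj p, by simp [hp]⟩
    · have hadj : (broom n d).Adj i j := by
        simp only [broom, SimpleGraph.fromRel_adj, ne_eq, Fin.ext_iff]
        omega
      refine ⟨.cons hadj .nil, ?_⟩
      simp only [SimpleGraph.Walk.length_cons, SimpleGraph.Walk.length_nil]
      omega

lemma exists_broom_walk_level {n d : ℕ} (i j : Fin n) (hi : i.val < d) :
    ∃ p : (broom n d).Walk i j, p.length = Nat.dist (broomLevel d i) (broomLevel d j) := by
  have hil : broomLevel d i = i.val := min_eq_left hi.le
  rcases le_total i.val (broomLevel d j) with h | h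
  · exact exists_broom_walk _ i j hi (by simp only [Nat.dist]; omega)
  · have hj : j.val < d ∧ broomLevel d j = j.val := by
      simp only [broomLevel] at h ⊢
      omega
    obtain ⟨p, hp⟩ := exists_broom_walk (Nat.dist (broomLevel d i) (broomLevel d j)) j i hj.1
      (by simp only [Nat.dist]; omega)
    exact ⟨p.reverse, by simpa using hp⟩

lemma broom_dist_eq {n d : ℕ} (i j : Fin n) (hi : i.val < d) :
    (broom n d).dist i j = Nat.dist (broomLevel d i) (broomLevel d j) := by
  obtain ⟨p, hp⟩ := exists_broom_walk_level i j hi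
  obtain ⟨q, hq⟩ := p.reachable.exists_walk_length_eq_dist
  exact le_antisymm (hp ▸ SimpleGraph.dist_le p) (hq ▸ broom_walk_level q)

lemma broom_connected_s13 {n d : ℕ} (hd : 0 < d) (hn : 0 < n) : (broom n d).Connected := by
  have h (j : Fin n) : (broom n d).Reachable ⟨0, hn⟩ j :=
    (exists_broom_walk_level ⟨0, hn⟩ j hd).choose.reachable
  exact { preconnected := fun i j => (h i).symm.trans (h j), nonempty := ⟨⟨0, hn⟩⟩ }

lemma broom_level_le_dist {n d : ℕ} (hd : 0 < d) (i j : Fin n) :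
    Nat.dist (broomLevel d i) (broomLevel d j) ≤ (broom n d).dist i j := by
  obtain ⟨q, hq⟩ := (broom_connected_s13 hd i.pos).exists_walk_length_eq_dist i j
  exact hq ▸ broom_walk_level q

lemma dist_le_ecc [Finite V] (G : SimpleGraph V) (u v : V) : G.dist u v ≤ ecc G u :=
  le_csSup (Set.finite_range _).bddAbove ⟨v, rfl⟩

/-- The middle vertex of the longest path through the handle is a center of the broom. -/
lemma broom_mid_mem_graphCenter {n d : ℕ} (hd : 0 < d) (hn : d < n) :
    (⟨d / 2, by omega⟩ : Fin n) ∈ graphCenter (broom n d) := by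
  intro u
  have hmid : ecc (broom n d) ⟨d / 2, by omega⟩ ≤ d - d / 2 := by
    refine csSup_le ⟨_, ⟨⟨0, by omega⟩, rfl⟩⟩ ?_
    rintro _ ⟨w, rfl⟩
    simp only [broom_dist_eq (⟨d / 2, by omega⟩ : Fin n) w (show d / 2 < d by omega)]
    simp only [broomLevel, Nat.dist]
    omega
  refine hmid.trans ?_
  have h0 := (broom_level_le_dist hd u ⟨0, by omega⟩).trans (dist_le_ecc (broom n d) u _)
  have h1 := (broom_level_le_dist hd u ⟨d, hn⟩).trans (dist_le_ecc (broom n d) u _)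
  simp only [broomLevel, Nat.dist] at h0 h1
  omega

/-- Moving one step along the handle towards the bristles changes the weight by the
difference of the orders of the two components left by deleting the traversed edge. -/
lemma broom_treeWeight_succ {n d v : ℕ} (hv : v + 1 < d) (hn : v + 1 < n) :
    treeWeight (broom n d) ⟨v + 1, hn⟩ + (n - 1 - v) =
      treeWeight (broom n d) ⟨v, by omega⟩ + (v + 1) := by
  have hr : ∑ u : Fin n, (if (⟨v, by omega⟩ : Fin n) < u then 1 else 0) = n - 1 - v := by
    rw [← Finset.card_filter, ← Fin.card_Ioi (⟨v, by omega⟩ : Fin n)]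
    congr 1
    ext
    simp
  have hl : ∑ u : Fin n, (if u ≤ (⟨v, by omega⟩ : Fin n) then 1 else 0) = v + 1 := by
    rw [← Finset.card_filter, ← Fin.card_Iic (⟨v, by omega⟩ : Fin n)]
    congr 1
    ext
    simp
  conv_lhs => rw [← hr]
  conv_rhs => rw [← hl]
  simp only [treeWeight]
  rw [← Finset.sum_add_distrib, ← Finset.sum_add_distrib]
  refine Finset.sum_congr rfl fun u _ => ?_
  rw [SimpleGraph.dist_comm, broom_dist_eq _ u hv, SimpleGraph.dist_comm,
    broom_dist_eq _ u (show v < d by omega)]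
  simp only [broomLevel, Nat.dist, Fin.lt_def, Fin.le_def]
  split_ifs <;> omega

lemma weightCenters_broom_ne_graphCenter {n d : ℕ} (hd : 3 ≤ d) (hn : d + 2 < n) :
    WeightCenters (broom n d) ≠ graphCenter (broom n d) := by
  intro h
  have hmid : (⟨d / 2, by omega⟩ : Fin n) ∈ WeightCenters (broom n d) :=
    h ▸ broom_mid_mem_graphCenter (by omega) (by omega)
  have hle := hmid ⟨d / 2 + 1, by omega⟩
  have hstep := broom_treeWeight_succ (n := n) (d := d) (v := d / 2) (by omega) (by omega)
  omega

/-- For `d ≥ 3` (brooms `B_{2k}` with `k ≥ 2` and `B_{2k+1}` with `k ≥ 1`) the set of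
weight centers differs from the center: `W(B_d) ≠ C(B_d)`. -/
theorem stmt13 :
    (∀ k : ℕ, 2 ≤ k →
      WeightCenters (broom (k * (2 * k + 1)) (2 * k)) ≠
        graphCenter (broom (k * (2 * k + 1)) (2 * k))) ∧
    (∀ k : ℕ, 1 ≤ k →
      WeightCenters (broom ((k + 1) * (2 * k + 1)) (2 * k + 1)) ≠
        graphCenter (broom ((k + 1) * (2 * k + 1)) (2 * k + 1))) := by
  refine ⟨fun k hk => weightCenters_broom_ne_graphCenter ?_ ?_,
    fun k hk => weightCenters_broom_ne_graphCenter ?_ ?_⟩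
  · omega
  · nlinarith
  · omega
  · nlinarith

end HCPaper
end
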